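/- In a stable theory, if p_0(x,b) ⟶ ... ⟶ p_{n-1}(x,b) ⟶ p_0(x,b) is a proper cycle of types over b, and b' is a tuple such that p_0(x,b) has only finitely many distinct nonforking extensions to bb', then there is a proper cycle of types starting with some nonforking extension p'_0(x; b,b') of p_0(x,b) whose length is a multiple of n. -/

import Mathlib

open FirstOrder FirstOrder.Language Set

universe u v w

namespace Equationality

variable {L : FirstOrder.Language.{u, v}}

section Struc
variable {M : Type w} [L.Structure M]

/-- The instance of the formula `φ(x; y)` at the parameter tuple `b`. -/
def instSet {α β : Type*} (φ : L.Formula (α ⊕ β)) (b : β → M) : Set (α → M) :=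
  {a | φ.Realize (Sum.elim a b)}

/-- A sequence of `γ`-tuples indexed by a linear order is indiscernible if any two strictly
increasing finite subsequences satisfy the same formulas. -/
def IsIndiscernible {I : Type*} [LinearOrder I] {γ : Type*} (a : I → γ → M) : Prop :=
  ∀ (n : ℕ) (i j : Fin n → I), StrictMono i → StrictMono j →
    ∀ φ : L.Formula (Fin n × γ),
      φ.Realize (fun p => a (i p.1) p.2) ↔ φ.Realize (fun p => a (j p.1) p.2)

/-- The complete type of a tuple over `∅`, as the set of formulas it realizes. -/
def typeOf {γ : Type*} (a : γ → M) : Set (L.Formula γ) := {φ | φ.Realize a}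

end Struc

variable (T : L.Theory)

/-- `φ(x; y)` is an equation for `T`: in every model of `T`, the family of finite
intersections of instances of `φ` has the descending chain condition. -/
def IsEquation {α β : Type*} (φ : L.Formula (α ⊕ β)) : Prop :=
  ∀ (M : Theory.ModelType.{u, v, max u v} T) (B : ℕ → Finset (β → M)),
    (Antitone fun n => ⋂ b ∈ B n, instSet φ b) →
    ∃ N, ∀ n, N ≤ n → (⋂ b ∈ B n, instSet φ b) = ⋂ b ∈ B N, instSet φ b

/-- A complete type over `∅` (in the variables `γ`), presented as the set of formulas
realized by some tuple in some model of `T`. -/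
def IsRealizedType {γ : Type*} (p : Set (L.Formula γ)) : Prop :=
  ∃ (M : Theory.ModelType.{u, v, max u v} T) (a : γ → M), typeOf a = p

/-- `p ⟶ q`: there are a model of `T`, a tuple `b` and an indiscernible sequence `(aᵢ)`
with `aᵢ ⊨ p(x, b)` for `i > 0` and `a₀ ⊨ q(x, b)`. -/
def Pf {α β : Type*} (p q : Set (L.Formula (α ⊕ β))) : Prop :=
  ∃ (M : Theory.ModelType.{u, v, max u v} T) (b : β → M) (a : ℕ → α → M),
    IsIndiscernible (L := L) a ∧ (∀ i : ℕ, 0 < i → typeOf (Sum.elim (a i) b) = p) ∧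
      typeOf (Sum.elim (a 0) b) = q

section Stab

variable {M : Type w} [L.Structure M]

/-- Indiscernibility over a set `C` of parameters. -/
def IsIndiscernibleOver (C : Set M) {I : Type*} [LinearOrder I] {γ : Type*}
    (a : I → γ → M) : Prop :=
  ∀ (n m : ℕ) (i j : Fin n → I), StrictMono i → StrictMono j →
    ∀ c : Fin m → M, (∀ t, c t ∈ C) →
      ∀ φ : L.Formula ((Fin n × γ) ⊕ Fin m),
        φ.Realize (Sum.elim (fun p => a (i p.1) p.2) c) ↔
          φ.Realize (Sum.elim (fun p => a (j p.1) p.2) c)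

/-- The formula `φ(x, d)` divides over `C`: there is a `C`-indiscernible sequence starting
at `d` along which the instances of `φ` are `k`-inconsistent. -/
def Divides {α γ : Type*} (φ : L.Formula (α ⊕ γ)) (d : γ → M) (C : Set M) : Prop :=
  ∃ (k : ℕ) (d' : ℕ → γ → M), 0 < k ∧ d' 0 = d ∧ IsIndiscernibleOver (L := L) C d' ∧
    ∀ s : Finset ℕ, s.card = k → ¬ ∃ a : α → M, ∀ i ∈ s, φ.Realize (Sum.elim a (d' i))

/-- `a` is forking-independent from `B` over `C` (in a stable theory, nonforking equals
nondividing): no formula of `tp(a / B ∪ C)` divides over `C`. -/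
def IndepOver {α : Type*} (a : α → M) (B C : Set M) : Prop :=
  ∀ (m : ℕ) (c : Fin m → M), (∀ t, c t ∈ B ∪ C) →
    ∀ φ : L.Formula (α ⊕ Fin m),
      φ.Realize (Sum.elim a c) → ¬ Divides (L := L) φ c C

/-- `p(x, b) ⟶ q(x, b)` for types over the parameter tuple `b` inside the model `M`. -/
def PfOver {α β : Type*} (b : β → M) (p q : Set (L.Formula (α ⊕ β))) : Prop :=
  ∃ a : ℕ → α → M, IsIndiscernible (L := L) a ∧
    (∀ i : ℕ, 0 < i → typeOf (Sum.elim (a i) b) = p) ∧ typeOf (Sum.elim (a 0) b) = q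

/-- A sufficiently saturated and homogeneous ("monster") structure: types over small parameter
sets are realized, and small tuples with the same type are conjugate step by step. -/
structure IsMonster (M : Type w) [L.Structure M] : Prop where
  saturated : ∀ (β : Type w) (b : β → M), Cardinal.mk β < Cardinal.mk M →
    ∀ (α : Type w), Finite α → ∀ Γ : Set (L.Formula (α ⊕ β)),
      (∀ Γ₀ : Finset (L.Formula (α ⊕ β)), ↑Γ₀ ⊆ Γ →
        ∃ a : α → M, ∀ φ ∈ Γ₀, φ.Realize (Sum.elim a b)) →
      ∃ a : α → M, ∀ φ ∈ Γ, φ.Realize (Sum.elim a b)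
  homogeneous : ∀ (β : Type w) (b b' : β → M), Cardinal.mk β < Cardinal.mk M →
    typeOf (L := L) b = typeOf b' → ∀ x : M, ∃ x' : M,
      typeOf (L := L) (Sum.elim (fun _ : Unit => x) b) =
        typeOf (Sum.elim (fun _ : Unit => x') b')

end Stab

/-- `T` is stable: no formula has the order property in a model of `T`. -/
def IsStable : Prop :=
  ∀ (n m : ℕ) (φ : L.Formula (Fin n ⊕ Fin m)) (M : Theory.ModelType.{u, v, max u v} T)
    (a : ℕ → Fin n → M) (b : ℕ → Fin m → M),
    ¬ ∀ i j : ℕ, φ.Realize (Sum.elim (a i) (b j)) ↔ i < j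
/-- `q` is a nonforking extension of `p(x, b)` to the parameters `b, b'`. -/
def IsNFExt {M : Type w} [L.Structure M] {α β β' : Type*} (b : β → M) (b' : β' → M)
    (p : Set (L.Formula (α ⊕ β))) (q : Set (L.Formula (α ⊕ (β ⊕ β')))) : Prop :=
  ∃ a : α → M, typeOf (Sum.elim a b) = p ∧ typeOf (Sum.elim a (Sum.elim b b')) = q ∧
    IndepOver (L := L) a (range b') (range b)

section Helpers

theorem mem_typeOf {M : Type*} [L.Structure M] {γ : Type*} {a : γ → M} {φ : L.Formula γ} :
    φ ∈ typeOf (L := L) a ↔ φ.Realize a := Iff.rfl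

theorem typeOf_iff {M N : Type*} [L.Structure M] [L.Structure N] {γ : Type*} {a : γ → M}
    {a' : γ → N} (h : typeOf (L := L) a = typeOf a') (φ : L.Formula γ) :
    φ.Realize a ↔ φ.Realize a' := by
  rw [← mem_typeOf, h, mem_typeOf]

theorem typeOf_comp {M N : Type*} [L.Structure M] [L.Structure N] {γ δ : Type*} {a : γ → M}
    {a' : γ → N} (h : typeOf (L := L) a = typeOf a') (f : δ → γ) :
    typeOf (L := L) (a ∘ f) = typeOf (a' ∘ f) := by
  ext φ
  rw [mem_typeOf, mem_typeOf, ← Formula.realize_relabel, ← Formula.realize_relabel]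
  exact typeOf_iff h _

theorem typeOf_eq_of_subset {M N : Type*} [L.Structure M] [L.Structure N] {γ : Type*}
    {a : γ → M} {a' : γ → N} (h : typeOf (L := L) a ⊆ typeOf a') :
    typeOf (L := L) a = typeOf a' := by
  refine Subset.antisymm h fun φ hφ => ?_
  by_contra hn
  have : φ.not ∈ typeOf (L := L) a := by
    rw [mem_typeOf, Formula.realize_not]; exact hn
  have := h this
  rw [mem_typeOf, Formula.realize_not] at this
  exact this hφ

/-- conjunction of a finite set of formulas -/
noncomputable def conj {γ : Type*} (s : Finset (L.Formula γ)) : L.Formula γ :=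
  Formula.iInf (fun φ : s => φ.1)

theorem realize_conj {M : Type*} [L.Structure M] {γ : Type*} (s : Finset (L.Formula γ))
    (v : γ → M) : (conj s).Realize v ↔ ∀ φ ∈ s, φ.Realize v := by
  simp [conj]

theorem sat_finite {M : Type (max u v)} [L.Structure M] (hM : IsMonster (L := L) M)
    (γ : Type (max u v)) [Finite γ] (c : γ → M)
    (Γ : Set (L.Formula (PUnit.{max u v + 1} ⊕ γ)))
    (h : ∀ Γ₀ : Finset (L.Formula (PUnit.{max u v + 1} ⊕ γ)), ↑Γ₀ ⊆ Γ →
        ∃ a : PUnit.{max u v + 1} → M, ∀ φ ∈ Γ₀, φ.Realize (Sum.elim a c)) :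
    ∃ a : PUnit.{max u v + 1} → M, ∀ φ ∈ Γ, φ.Realize (Sum.elim a c) := by
  classical
  rcases finite_or_infinite M with hf | hi
  · by_contra hcon
    push Not at hcon
    choose f hf1 hf2 using hcon
    have := Fintype.ofFinite (PUnit.{max u v + 1} → M)
    obtain ⟨a, ha⟩ := h (Finset.univ.image f) (by
      intro φ hφ
      simp only [Finset.coe_image, Finset.coe_univ, Set.image_univ, Set.mem_range] at hφ
      obtain ⟨a, rfl⟩ := hφ
      exact hf1 a)
    exact hf2 a (ha _ (Finset.mem_image_of_mem _ (Finset.mem_univ _)))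
  · refine hM.saturated γ c ?_ _ inferInstance Γ h
    exact (Cardinal.lt_aleph0_of_finite γ).trans_le (Cardinal.aleph0_le_mk M)

theorem one_step {M : Type (max u v)} [L.Structure M] (hM : IsMonster (L := L) M)
    {N : Type*} [L.Structure N] {γ : Type*} [Finite γ] (c : γ → N) (c' : γ → M)
    (h : typeOf (L := L) c = typeOf c') (x : N) :
    ∃ x' : M, typeOf (L := L) (Sum.elim c (fun _ : Unit => x)) =
      typeOf (Sum.elim c' (fun _ : Unit => x')) := by
  classical
  let e : γ ≃ ULift.{max u v} (Fin (Nat.card γ)) := (Finite.equivFin γ).trans Equiv.ulift.symm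
  let g : PUnit.{max u v + 1} ⊕ ULift.{max u v} (Fin (Nat.card γ)) → γ ⊕ Unit :=
    Sum.elim (fun _ => Sum.inr ()) (Sum.inl ∘ e.symm)
  have key := sat_finite hM (ULift.{max u v} (Fin (Nat.card γ))) (c' ∘ e.symm)
    (typeOf (L := L) ((Sum.elim c (fun _ : Unit => x)) ∘ g)) (by
      intro Γ₀ hΓ
      have h1 : (((conj Γ₀).relabel g).iExs Unit).Realize c := by
        rw [Formula.realize_iExs]
        refine ⟨fun _ => x, ?_⟩
        rw [Formula.realize_relabel, realize_conj]
        exact fun φ hφ => hΓ hφ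
      have h2 := (typeOf_iff h _).1 h1
      rw [Formula.realize_iExs] at h2
      obtain ⟨y, hy⟩ := h2
      rw [Formula.realize_relabel, realize_conj] at hy
      refine ⟨fun _ => y (), fun φ hφ => ?_⟩
      convert hy φ hφ using 1
      ext (i | i) <;> rfl)
  obtain ⟨y, hy⟩ := key
  refine ⟨y PUnit.unit, ?_⟩
  have h3 : typeOf (L := L) ((Sum.elim c (fun _ : Unit => x)) ∘ g) =
      typeOf (Sum.elim y (c' ∘ e.symm)) := typeOf_eq_of_subset hy
  have h4 := typeOf_comp h3 (δ := γ ⊕ Unit)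
    (Sum.elim (fun i => Sum.inr (e i)) (fun _ => Sum.inl PUnit.unit))
  convert h4 using 2
  · ext (i | i) <;> simp [g]
  · ext (i | i) <;> simp

theorem typeOf_nat {M N : Type*} [L.Structure M] [L.Structure N] {γ : Type*}
    (c : γ → N) (c' : γ → M) (d : ℕ → N) (d' : ℕ → M)
    (h : ∀ k : ℕ, typeOf (L := L) (Sum.elim c (fun i : Fin k => d i)) =
      typeOf (Sum.elim c' (fun i : Fin k => d' i))) :
    typeOf (L := L) (Sum.elim c d) = typeOf (Sum.elim c' d') := by
  classical
  ext φ
  obtain ⟨k, hk⟩ : ∃ k : ℕ, ∀ i : ℕ, (Sum.inr i : γ ⊕ ℕ) ∈ φ.freeVarFinset → i < k := by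
    refine ⟨(φ.freeVarFinset.toRight).sup id + 1, fun i hi => Nat.lt_succ_of_le ?_⟩
    exact Finset.le_sup (f := id) (Finset.mem_toRight.2 hi)
  let f : φ.freeVarFinset → γ ⊕ Fin k := fun a => match a with
    | ⟨Sum.inl g, _⟩ => Sum.inl g
    | ⟨Sum.inr i, hi⟩ => Sum.inr ⟨i, hk i hi⟩
  let ψ : L.Formula (γ ⊕ Fin k) := BoundedFormula.restrictFreeVar φ f
  have h1 : Formula.Realize ψ
      (Sum.elim c (fun i : Fin k => d i)) ↔ φ.Realize (Sum.elim c d) := by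
    refine BoundedFormula.realize_restrictFreeVar _ ?_
    rintro ⟨g | i, hi⟩ <;> rfl
  have h2 : Formula.Realize ψ
      (Sum.elim c' (fun i : Fin k => d' i)) ↔ φ.Realize (Sum.elim c' d') := by
    refine BoundedFormula.realize_restrictFreeVar _ ?_
    rintro ⟨g | i, hi⟩ <;> rfl
  rw [mem_typeOf, mem_typeOf, ← h1, ← h2]
  exact typeOf_iff (h k) _

theorem extend_nat {M : Type (max u v)} [L.Structure M] [Nonempty M] (hM : IsMonster (L := L) M)
    {N : Type*} [L.Structure N] {γ : Type*} [Finite γ] (c : γ → N) (c' : γ → M)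
    (h : typeOf (L := L) c = typeOf c') (d : ℕ → N) :
    ∃ d' : ℕ → M, typeOf (L := L) (Sum.elim c d) = typeOf (Sum.elim c' d') := by
  classical
  let P : ℕ → (ℕ → M) → Prop := fun k f =>
    typeOf (L := L) (Sum.elim c (fun i : Fin k => d i)) =
      typeOf (Sum.elim c' (fun i : Fin k => f i))
  have step : ∀ (k : ℕ) (f : ℕ → M), P k f → ∃ f', P (k + 1) f' ∧ ∀ i < k, f' i = f i := by
    intro k f hf
    obtain ⟨x, hx⟩ := one_step hM _ _ hf (d k)
    refine ⟨Function.update f k x, ?_, fun i hi => by simp [hi.ne]⟩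
    have h4 := typeOf_comp hx (δ := γ ⊕ Fin (k + 1)) (Sum.elim (fun i => Sum.inl (Sum.inl i))
      (fun i => if hi : i.1 < k then Sum.inl (Sum.inr ⟨i.1, hi⟩) else Sum.inr ()))
    change typeOf (L := L) _ = _
    convert h4 using 2
    · ext (i | i)
      · rfl
      · by_cases hi : i.1 < k
        · simp [hi]
        · have : i.1 = k := by omega
          simp [this]
    · ext (i | i)
      · rfl
      · by_cases hi : i.1 < k
        · simp [hi, hi.ne]
        · have : i.1 = k := by omega
          simp [this]
  choose! F hF1 hF2 using step
  have h0 : P 0 (fun _ => Classical.arbitrary M) := by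
    have h4 := typeOf_comp h (δ := γ ⊕ Fin 0) (Sum.elim id (fun i => i.elim0))
    change typeOf (L := L) _ = _
    convert h4 using 2
    · ext (i | i)
      · rfl
      · exact i.elim0
    · ext (i | i)
      · rfl
      · exact i.elim0
  let G : ℕ → ℕ → M := fun k => Nat.rec (fun _ => Classical.arbitrary M) (fun k f => F k f) k
  have hG : ∀ k, P k (G k) := by
    intro k
    induction k with
    | zero => exact h0
    | succ k ih => exact hF1 k _ ih
  have hG2 : ∀ i k, i < k → G k i = G (i + 1) i := by
    intro i k hik
    induction k with
    | zero => omega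
    | succ k ih =>
      rcases Nat.lt_succ_iff_lt_or_eq.1 hik with h1 | h1
      · rw [← ih h1]; exact hF2 k _ (hG k) i h1
      · subst h1; rfl
  refine ⟨fun i => G (i + 1) i, typeOf_nat _ _ _ _ fun k => ?_⟩
  have := hG k
  change typeOf (L := L) _ = _ at this
  rw [this]
  congr 2
  ext i
  exact hG2 _ _ i.2

theorem extend_countable {M : Type (max u v)} [L.Structure M] [Nonempty M]
    (hM : IsMonster (L := L) M)
    {N : Type*} [L.Structure N] {γ : Type*} [Finite γ] (c : γ → N) (c' : γ → M)
    (h : typeOf (L := L) c = typeOf c') {I : Type*} [Countable I] (d : I → N) :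
    ∃ d' : I → M, typeOf (L := L) (Sum.elim c d) = typeOf (Sum.elim c' d') := by
  rcases isEmpty_or_nonempty I with hI | hI
  · refine ⟨fun i => isEmptyElim i, ?_⟩
    have h4 := typeOf_comp h (δ := γ ⊕ I) (Sum.elim id (fun i => isEmptyElim i))
    convert h4 using 2
    · ext (i | i)
      · rfl
      · exact isEmptyElim i
    · ext (i | i)
      · rfl
      · exact isEmptyElim i
  · obtain ⟨s, hs⟩ := exists_surjective_nat I
    obtain ⟨d', hd'⟩ := extend_nat hM c c' h (d ∘ s)
    obtain ⟨g, hg⟩ := hs.hasRightInverse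
    refine ⟨d' ∘ g, ?_⟩
    have h4 := typeOf_comp hd' (δ := γ ⊕ I) (Sum.map id g)
    convert h4 using 2
    · ext (i | i)
      · rfl
      · simp [hg i]
    · ext (i | i) <;> rfl

theorem sat_countable {M : Type (max u v)} [L.Structure M] [Nonempty M]
    (hM : IsMonster (L := L) M) {γ : Type*} [Finite γ] (c : γ → M) {I : Type*} [Countable I]
    (Γ : Set (L.Formula (I ⊕ γ)))
    (h : ∀ Γ₀ : Finset (L.Formula (I ⊕ γ)), ↑Γ₀ ⊆ Γ →
        ∃ a : I → M, ∀ φ ∈ Γ₀, φ.Realize (Sum.elim a c)) :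
    ∃ a : I → M, ∀ φ ∈ Γ, φ.Realize (Sum.elim a c) := by
  classical
  let Γ' : Set (L.Formula (I ⊕ γ)) := Γ ∪ (Formula.relabel Sum.inr) '' (typeOf (L := L) c)
  let Th : L[[I ⊕ γ]].Theory := Formula.equivSentence '' Γ'
  have hsat : Th.IsSatisfiable := by
    rw [Theory.isSatisfiable_iff_isFinitelySatisfiable]
    intro T0 hT0
    obtain ⟨a, ha⟩ := h ((T0.image Formula.equivSentence.symm).filter (· ∈ Γ))
      (by intro φ hφ; simp at hφ; exact hφ.2)
    let _ : (constantsOn (I ⊕ γ)).Structure M := constantsOn.structure (Sum.elim a c)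
    have : M ⊨ (T0 : L[[I ⊕ γ]].Theory) := by
      rw [Theory.model_iff]
      intro ψ hψ
      obtain ⟨φ, hφ, rfl⟩ := hT0 hψ
      have hcon : (fun i => (L.con i : M)) = Sum.elim a c := rfl
      rw [Formula.realize_equivSentence, hcon]
      rcases hφ with hφ | ⟨χ, hχ, rfl⟩
      · refine ha φ ?_
        simp only [Finset.mem_filter, Finset.mem_image]
        exact ⟨⟨_, hψ, by simp⟩, hφ⟩
      · rw [Formula.realize_relabel]; exact hχ
    exact Theory.Model.isSatisfiable M
  obtain ⟨N⟩ := hsat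
  let _ : L.Structure N := (L.lhomWithConstants (I ⊕ γ)).reduct N
  have hexp : (L.lhomWithConstants (I ⊕ γ)).IsExpansionOn N := LHom.isExpansionOn_reduct _ _
  let w : I ⊕ γ → N := fun i => (L.con i : N)
  have hN : ∀ φ ∈ Γ', φ.Realize w := by
    intro φ hφ
    rw [← Formula.realize_equivSentence]
    exact Theory.realize_sentence_of_mem Th (mem_image_of_mem _ hφ)
  have htp : typeOf (L := L) (w ∘ Sum.inr) = typeOf c := by
    refine (typeOf_eq_of_subset fun φ hφ => ?_).symm
    have := hN (φ.relabel Sum.inr) (Or.inr (mem_image_of_mem _ hφ))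
    rwa [Formula.realize_relabel] at this
  obtain ⟨a, ha⟩ := extend_countable hM _ _ htp (w ∘ Sum.inl)
  refine ⟨a, fun φ hφ => ?_⟩
  have h4 := typeOf_comp ha (δ := I ⊕ γ) Sum.swap
  have h5 := typeOf_iff h4 φ
  have e1 : Sum.elim (w ∘ Sum.inr) (w ∘ Sum.inl) ∘ Sum.swap = w := by
    ext (i | i) <;> rfl
  have e2 : Sum.elim c a ∘ Sum.swap = Sum.elim a c := by
    ext (i | i) <;> rfl
  rw [e1, e2] at h5
  exact h5.1 (hN φ (Or.inl hφ))

section Rank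

variable {X : Type*} {ι : Type*} {P : ι → Type*} (R : (l : ι) → X → P l → Prop) (k : ι → ℕ)

/-- The instances of `R l` along `d` are `k l`-inconsistent. -/
def Inc (l : ι) (d : ℕ → P l) : Prop :=
  ∀ s : Finset ℕ, s.card = k l → ¬ ∃ x, ∀ i ∈ s, R l x (d i)

theorem Inc.finite {l : ι} {d : ℕ → P l} (h : Inc R k l d) (x : X) :
    {j | R l x (d j)}.Finite := by
  by_contra hinf
  obtain ⟨s, hs, hc⟩ := Set.Infinite.exists_subset_card_eq hinf (k l)
  exact h s hc ⟨x, fun i hi => hs hi⟩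

theorem Inc.comp {l : ι} {d : ℕ → P l} (h : Inc R k l d) (f : ℕ → ℕ)
    (hf : Function.Injective f) : Inc R k l (d ∘ f) := by
  intro s hs ⟨x, hx⟩
  refine h (s.map ⟨f, hf⟩) (by simpa using hs) ⟨x, ?_⟩
  intro i hi
  obtain ⟨j, hj, rfl⟩ := Finset.mem_map.1 hi
  exact hx j hj

/-- `D o A`: the dividing rank of `A` is at least `o`. -/
def D (o : Ordinal.{w}) (A : Set X) : Prop :=
  A.Nonempty ∧ ∀ o' : Ordinal.{w}, ∀ _ : o' < o, ∃ (l : ι) (d : ℕ → P l), Inc R k l d ∧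
    ∀ j, D o' (A ∩ {x | R l x (d j)})
termination_by o

theorem D_iff (o : Ordinal.{w}) (A : Set X) : D R k o A ↔
  A.Nonempty ∧ ∀ o' : Ordinal.{w}, o' < o → ∃ (l : ι) (d : ℕ → P l), Inc R k l d ∧
    ∀ j, D R k o' (A ∩ {x | R l x (d j)}) := by
  rw [D]

theorem D.anti {o o' : Ordinal.{w}} {A : Set X} (h : D R k o A) (ho : o' ≤ o) : D R k o' A := by
  rw [D_iff] at h ⊢
  exact ⟨h.1, fun o'' h'' => h.2 o'' (h''.trans_le ho)⟩

theorem D_iUnion {κ : Type*} [Finite κ] (o : Ordinal.{w}) : ∀ (A : κ → Set X),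
    D R k o (⋃ t, A t) → ∃ t, D R k o (A t) := by
  induction o using WellFoundedLT.induction with
  | ind o ih =>
  intro A hA
  by_contra hcon
  push Not at hcon
  -- each `t` with nonempty `A t` has a bad ordinal
  have hbad : ∀ t, ∃ o₁, (0 < o → o₁ < o) ∧ ((A t).Nonempty → o₁ < o ∧
      ¬ ∃ (l : ι) (d : ℕ → P l), Inc R k l d ∧ ∀ j, D R k o₁ (A t ∩ {x | R l x (d j)})) := by
    intro t
    by_cases hne : (A t).Nonempty
    · have := hcon t
      rw [D_iff] at this
      push Not at this
      obtain ⟨o₁, h1, h2⟩ := this hne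
      refine ⟨o₁, fun _ => h1, fun _ => ⟨h1, ?_⟩⟩
      rintro ⟨l, d, hi, hd⟩
      obtain ⟨j, hj⟩ := h2 l d hi
      exact hj (hd j)
    · exact ⟨0, id, fun h => absurd h hne⟩
  choose f hf1 hf2 using hbad
  rw [D_iff] at hA
  obtain ⟨x, hx⟩ := hA.1
  obtain ⟨t₀, ht₀⟩ := mem_iUnion.1 hx
  have hpos : 0 < o := (zero_le (a := f t₀)).trans_lt (hf2 t₀ ⟨x, ht₀⟩).1
  have : Nonempty κ := ⟨t₀⟩
  obtain ⟨t₁, ht₁⟩ := Finite.exists_max f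
  obtain ⟨l, d, hi, hd⟩ := hA.2 (f t₁) (hf1 t₁ hpos)
  have hch : ∀ j, ∃ t, D R k (f t₁) (A t ∩ {x | R l x (d j)}) := by
    intro j
    apply ih (f t₁) (hf1 t₁ hpos) (fun t => A t ∩ {x | R l x (d j)})
    rw [← iUnion_inter]
    exact hd j
  choose g hg using hch
  obtain ⟨t, ht⟩ := Finite.exists_infinite_fiber g
  have hinf : {j | g j = t}.Infinite := Set.infinite_coe_iff.1 ht
  let e := Nat.nth (fun j => g j = t)
  have he : ∀ j, g (e j) = t := Nat.nth_mem_of_infinite hinf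
  have hD : ∀ j, D R k (f t) (A t ∩ {x | R l x ((d ∘ e) j)}) := by
    intro j
    have := hg (e j)
    rw [he] at this
    exact this.anti R k (ht₁ t)
  have hne : (A t).Nonempty := by
    have := hD 0
    rw [D_iff] at this
    exact this.1.mono inter_subset_left
  exact (hf2 t hne).2 ⟨l, d ∘ e, hi.comp R k e (Nat.nth_injective hinf), hD⟩

end Rank

section Rank2

variable {X : Type w} {ι : Type w} {P : ι → Type w} (R : (l : ι) → X → P l → Prop) (k : ι → ℕ)

theorem D_top {A : Set X} (h : ∀ o : Ordinal.{w}, D R k o A) :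
    ∃ (l : ι) (d : ℕ → P l), Inc R k l d ∧
      ∀ j, ∀ o : Ordinal.{w}, D R k o (A ∩ {x | R l x (d j)}) := by
  by_contra hcon
  push Not at hcon
  have h' : ∀ q : (Σ l : ι, ℕ → P l), ∃ o : Ordinal.{w}, Inc R k q.1 q.2 →
      ∃ j, ¬ D R k o (A ∩ {x | R q.1 x (q.2 j)}) := by
    rintro ⟨l, d⟩
    by_cases hi : Inc R k l d
    · obtain ⟨j, o, ho⟩ := hcon l d hi
      exact ⟨o, fun _ => ⟨j, ho⟩⟩
    · exact ⟨0, fun h => absurd h hi⟩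
  choose f hf using h'
  have h1 := h (Order.succ (⨆ q, f q))
  rw [D_iff] at h1
  obtain ⟨l, d, hi, hd⟩ := h1.2 _ (Order.lt_succ _)
  obtain ⟨j, hj⟩ := hf ⟨l, d⟩ hi
  exact hj ((hd j).anti R k (Ordinal.le_iSup f ⟨l, d⟩))

theorem order_of_D_top [Finite ι] {A : Set X} (h : ∀ o : Ordinal.{w}, D R k o A) :
    ∃ (l : ι) (e : ℕ → X) (d : ℕ → P l), ∀ i j, R l (e i) (d j) ↔ j < i := by
  classical
  have step : ∀ (A : Set X) (F : Finset X), (∀ o : Ordinal.{w}, D R k o A) →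
      ∃ (q : Σ l : ι, P l), (∀ o : Ordinal.{w}, D R k o (A ∩ {x | R q.1 x q.2})) ∧
        ∀ x ∈ F, ¬ R q.1 x q.2 := by
    intro A F hA
    obtain ⟨l, d, hi, hd⟩ := D_top R k hA
    have hfin : (⋃ x ∈ F, {j | R l x (d j)}).Finite :=
      Set.Finite.biUnion F.finite_toSet fun x _ => hi.finite R k x
    obtain ⟨j, hj⟩ := hfin.exists_notMem
    refine ⟨⟨l, d j⟩, hd j, fun x hx hR => hj ?_⟩
    exact mem_biUnion (show x ∈ (F : Set X) from hx) hR
  have : Nonempty (Σ l : ι, P l) := ⟨(step A ∅ h).choose⟩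
  choose! q hq1 hq2 using step
  have hne : ∀ A : Set X, (∀ o : Ordinal.{w}, D R k o A) → ∃ x, x ∈ A := by
    intro A hA
    have := hA 0
    rw [D_iff] at this
    exact this.1
  obtain ⟨x0, hx0⟩ := hne A h
  have : Nonempty X := ⟨x0⟩
  choose! pt hpt using hne
  -- the states: current set, and finite set of points chosen so far
  let nxt : Set X × Finset X → Set X × Finset X := fun s =>
    (s.1 ∩ {x | R (q s.1 (insert (pt s.1) s.2)).1 x (q s.1 (insert (pt s.1) s.2)).2},
      insert (pt s.1) s.2)
  let S : ℕ → Set X × Finset X := fun t => nxt^[t] (A, ∅)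
  have hS : ∀ t, S (t + 1) = nxt (S t) := fun t => Function.iterate_succ_apply' _ _ _
  have hgood : ∀ t, ∀ o : Ordinal.{w}, D R k o (S t).1 := by
    intro t
    induction t with
    | zero => exact h
    | succ t ih =>
      rw [hS]
      exact hq1 _ _ ih
  let e : ℕ → X := fun t => pt (S t).1
  let qq : ℕ → Σ l : ι, P l := fun t => q (S t).1 (insert (pt (S t).1) (S t).2)
  have hanti : Antitone fun t => (S t).1 := by
    refine antitone_nat_of_succ_le fun t => ?_
    rw [hS]
    exact inter_subset_left
  have hmono : Monotone fun t => (S t).2 := by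
    refine monotone_nat_of_le_succ fun t => ?_
    rw [hS]
    exact Finset.subset_insert _ _
  have hR : ∀ i j, R (qq j).1 (e i) (qq j).2 ↔ j < i := by
    intro i j
    constructor
    · intro hr
      by_contra hij
      refine hq2 (S j).1 (insert (pt (S j).1) (S j).2) (hgood j) (e i) ?_ hr
      rcases (not_lt.1 hij).eq_or_lt with h1 | h1
      · subst h1; exact Finset.mem_insert_self _ _
      · refine Finset.mem_insert_of_mem (hmono (Nat.succ_le_of_lt h1) ?_)
        change _ ∈ (S (i + 1)).2
        rw [hS]
        exact Finset.mem_insert_self _ _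
    · intro hij
      have h1 : e i ∈ (S (j + 1)).1 := hanti (Nat.succ_le_of_lt hij) (hpt _ (hgood i))
      rw [hS] at h1
      exact h1.2
  obtain ⟨l, hl⟩ := Finite.exists_infinite_fiber (fun j => (qq j).1)
  have hinf : {j | (qq j).1 = l}.Infinite := Set.infinite_coe_iff.1 hl
  let f := Nat.nth (fun j => (qq j).1 = l)
  have hf : ∀ j, (qq (f j)).1 = l := Nat.nth_mem_of_infinite hinf
  have hd : ∀ j, ∃ d : P l, qq (f j) = ⟨l, d⟩ := by
    intro j
    have := hf j
    rcases hqq : qq (f j) with ⟨l', d'⟩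
    rw [hqq] at this
    simp only at this
    subst this
    exact ⟨d', rfl⟩
  choose d hd using hd
  refine ⟨l, fun i => e (f i), d, fun i j => ?_⟩
  have := hR (f i) (f j)
  rw [hd] at this
  rw [this]
  exact (Nat.nth_strictMono hinf).lt_iff_lt

end Rank2

section Core

theorem stable_fin (hst : IsStable T) (M : Theory.ModelType.{u, v, max u v} T)
    {α : Type*} [Finite α] {m : ℕ} (φ : L.Formula (α ⊕ Fin m)) (e : ℕ → α → M)
    (d : ℕ → Fin m → M) (h : ∀ i j, φ.Realize (Sum.elim (e i) (d j)) ↔ j < i) : False := by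
  let g := Finite.equivFin α
  refine hst (Nat.card α) m (φ.relabel (Sum.map g id)).not M
    (fun i => e (i + 1) ∘ g.symm) d fun i j => ?_
  rw [Formula.realize_not, Formula.realize_relabel]
  have : Sum.elim (e (i + 1) ∘ g.symm) (d j) ∘ Sum.map g id = Sum.elim (e (i + 1)) (d j) := by
    ext (x | x) <;> simp
  rw [this, h]
  omega

theorem D_inv {M : Type (max u v)} [L.Structure M] [Nonempty M] (hM : IsMonster (L := L) M)
    {α V ι : Type (max u v)} [Countable V] (s : ι → α → V) (m : ι → ℕ)
    (φ : (l : ι) → L.Formula (α ⊕ Fin (m l))) (k : ι → ℕ) (o : Ordinal.{max u v}) :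
    ∀ (γ : Type (max u v)) [Finite γ] (ψ : L.Formula (V ⊕ γ)) (c c' : γ → M),
      typeOf (L := L) c = typeOf c' →
      D (fun l (x : V → M) (d : Fin (m l) → M) => (φ l).Realize (Sum.elim (x ∘ s l) d)) k o
        {x | ψ.Realize (Sum.elim x c)} →
      D (fun l (x : V → M) (d : Fin (m l) → M) => (φ l).Realize (Sum.elim (x ∘ s l) d)) k o
        {x | ψ.Realize (Sum.elim x c')} := by
  induction o using WellFoundedLT.induction with
  | ind o ih =>
  intro γ _ ψ c c' hcc hD
  rw [D_iff] at hD ⊢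
  constructor
  · obtain ⟨x, hx⟩ := hD.1
    obtain ⟨x', hx'⟩ := extend_countable hM c c' hcc x
    refine ⟨x', ?_⟩
    have h1 := typeOf_iff (typeOf_comp hx' (δ := V ⊕ γ) Sum.swap) ψ
    have e1 : Sum.elim c x ∘ Sum.swap = Sum.elim x c := by ext (i | i) <;> rfl
    have e2 : Sum.elim c' x' ∘ Sum.swap = Sum.elim x' c' := by ext (i | i) <;> rfl
    rw [e1, e2] at h1
    exact h1.1 hx
  · intro o' ho'
    obtain ⟨l, d, hi, hd⟩ := hD.2 o' ho'
    obtain ⟨d', hd'⟩ := extend_countable hM c c' hcc (fun p : ℕ × Fin (m l) => d p.1 p.2)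
    refine ⟨l, fun j t => d' (j, t), ?_, fun j => ?_⟩
    · intro S hS
      rintro ⟨x, hx⟩
      have h1 := typeOf_comp hd' (δ := S × Fin (m l)) (fun p => Sum.inr (p.1.1, p.2))
      obtain ⟨x', hx'⟩ := extend_countable hM _ _ h1.symm x
      refine hi S hS ⟨x', fun i hiS => ?_⟩
      have h2 := typeOf_iff (typeOf_comp hx' (δ := α ⊕ Fin (m l))
        (Sum.elim (fun a => Sum.inr (s l a)) (fun t => Sum.inl (⟨i, hiS⟩, t)))) (φ l)
      have h3 : (φ l).Realize (Sum.elim (x ∘ s l) (fun t => d' (i, t))) := hx i hiS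
      refine (iff_of_eq ?_).1 (h2.1 ((iff_of_eq ?_).1 h3))
      · refine congrArg (φ l).Realize ?_
        ext (y | y) <;> rfl
      · refine congrArg (φ l).Realize ?_
        ext (y | y) <;> rfl
    · have h1 := typeOf_comp hd' (δ := γ ⊕ Fin (m l))
        (Sum.elim Sum.inl (fun t => Sum.inr (j, t)))
      have e1 : (Sum.elim c fun p : ℕ × Fin (m l) => d p.1 p.2) ∘
          (Sum.elim Sum.inl (fun t => Sum.inr (j, t))) = Sum.elim c (d j) := by
        ext (i | i) <;> rfl
      have e2 : (Sum.elim c' d') ∘ (Sum.elim Sum.inl (fun t => Sum.inr (j, t))) =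
          Sum.elim c' (fun t => d' (j, t)) := by
        ext (i | i) <;> rfl
      rw [e1, e2] at h1
      have h2 := ih o' ho' (γ ⊕ Fin (m l))
        ((ψ.relabel (Sum.map id Sum.inl)) ⊓ ((φ l).relabel (Sum.map (s l) Sum.inr))) _ _ h1
      have e3 : ∀ (c : γ → M) (d : Fin (m l) → M),
          {x : V → M | ((ψ.relabel (Sum.map id Sum.inl)) ⊓
            ((φ l).relabel (Sum.map (s l) Sum.inr))).Realize (Sum.elim x (Sum.elim c d))} =
          {x | ψ.Realize (Sum.elim x c)} ∩
            {x | (φ l).Realize (Sum.elim (x ∘ s l) d)} := by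
        intro c d
        ext x
        simp only [Formula.realize_inf, Formula.realize_relabel, mem_setOf_eq, mem_inter_iff]
        have e4 : Sum.elim x (Sum.elim c d) ∘ Sum.map id Sum.inl = Sum.elim x c := by
          ext (i | i) <;> rfl
        have e5 : Sum.elim x (Sum.elim c d) ∘ Sum.map (s l) Sum.inr =
            Sum.elim (x ∘ s l) d := by
          ext (i | i) <;> rfl
        rw [e4, e5]
      rw [e3, e3] at h2
      exact h2 (hd j)

theorem indiscOver_type {M : Type*} [L.Structure M] {β γ : Type*} [Finite β] (b : β → M)
    (d : ℕ → γ → M) (h : IsIndiscernibleOver (L := L) (range b) d) (i j : ℕ) :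
    typeOf (L := L) (Sum.elim b (d i)) = typeOf (Sum.elim b (d j)) := by
  let g := Finite.equivFin β
  ext φ
  have := h 1 (Nat.card β) (fun _ => i) (fun _ => j) (Subsingleton.strictMono _)
    (Subsingleton.strictMono _) (b ∘ g.symm) (fun t => mem_range_self _)
    (φ.relabel (Sum.elim (fun x => Sum.inr (g x)) (fun y => Sum.inl (0, y))))
  rw [Formula.realize_relabel, Formula.realize_relabel] at this
  rw [mem_typeOf, mem_typeOf]
  convert this using 2
  · ext (x | x) <;> simp
  · ext (x | x) <;> simp

theorem core (hst : IsStable T) (M : Theory.ModelType.{u, v, max u v} T)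
    (hM : IsMonster (L := L) M) {α β V ι : Type (max u v)} [Finite α] [Finite β] [Countable V]
    [Finite ι] (b : β → M) (θ : L.Formula (V ⊕ β)) (E : V → M) (hE : θ.Realize (Sum.elim E b))
    (s : ι → α → V) (m : ι → ℕ) (φ : (l : ι) → L.Formula (α ⊕ Fin (m l)))
    (c : (l : ι) → Fin (m l) → M)
    (hdiv : ∀ l, Divides (L := L) (φ l) (c l) (range b)) :
    ∃ x : V → M, θ.Realize (Sum.elim x b) ∧
      ∀ l, ¬ (φ l).Realize (Sum.elim (x ∘ s l) (c l)) := by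
  by_contra hcon
  push Not at hcon
  choose k d hk hd0 hdi hdinc using hdiv
  have key : ∀ o : Ordinal.{max u v},
      D (fun l (x : V → M) (d : Fin (m l) → M) => (φ l).Realize (Sum.elim (x ∘ s l) d)) k o
        {x | θ.Realize (Sum.elim x b)} := by
    intro o
    induction o using WellFoundedLT.induction with
    | ind o ih =>
    rw [D_iff]
    refine ⟨⟨E, hE⟩, fun o' ho' => ?_⟩
    have h1 := ih o' ho'
    have e3 : ∀ l (c : Fin (m l) → M),
        {x : V → M | ((θ.relabel (Sum.map id Sum.inl)) ⊓
          ((φ l).relabel (Sum.map (s l) Sum.inr))).Realize (Sum.elim x (Sum.elim b c))} =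
        {x | θ.Realize (Sum.elim x b)} ∩
          {x | (φ l).Realize (Sum.elim (x ∘ s l) c)} := by
      intro l c
      ext x
      simp only [Formula.realize_inf, Formula.realize_relabel, mem_setOf_eq, mem_inter_iff]
      have e4 : Sum.elim x (Sum.elim b c) ∘ Sum.map id Sum.inl = Sum.elim x b := by
        ext (i | i) <;> rfl
      have e5 : Sum.elim x (Sum.elim b c) ∘ Sum.map (s l) Sum.inr =
          Sum.elim (x ∘ s l) c := by
        ext (i | i) <;> rfl
      rw [e4, e5]
    have hun : {x : V → M | θ.Realize (Sum.elim x b)} =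
        ⋃ l, ({x | θ.Realize (Sum.elim x b)} ∩
          {x | (φ l).Realize (Sum.elim (x ∘ s l) (c l))}) := by
      ext x
      simp only [mem_iUnion, mem_inter_iff, mem_setOf_eq]
      constructor
      · intro hx
        obtain ⟨l, hl⟩ := hcon x hx
        exact ⟨l, hx, hl⟩
      · rintro ⟨l, hx, -⟩
        exact hx
    rw [hun] at h1
    obtain ⟨l, hl⟩ := D_iUnion _ _ _ _ h1
    refine ⟨l, d l, ?_, fun j => ?_⟩
    · intro S hS
      rintro ⟨x, hx⟩
      exact hdinc l S hS ⟨x ∘ s l, hx⟩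
    · rw [← e3] at hl ⊢
      refine D_inv hM s m φ k o' _ _ _ _ ?_ hl
      have := indiscOver_type b (d l) (hdi l) 0 j
      rwa [hd0] at this
  obtain ⟨l, e, d', h⟩ := order_of_D_top _ _ key
  exact stable_fin T hst M (φ l) (fun i => e i ∘ s l) d' h

theorem exists_indep (hst : IsStable T) (M : Theory.ModelType.{u, v, max u v} T)
    (hM : IsMonster (L := L) M) {α β β' : Type (max u v)} {J : Type} [Countable J]
    [Finite α] [Finite β] [Finite β'] (b : β → M) (b' : β' → M) (E : J × α → M) :
    ∃ E' : J × α → M, typeOf (L := L) (Sum.elim E b) = typeOf (Sum.elim E' b) ∧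
      ∀ σ, IndepOver (L := L) (fun x => E' (σ, x)) (range b') (range b) := by
  classical
  let Γ1 : Set (L.Formula ((J × α) ⊕ (β ⊕ β'))) :=
    (Formula.relabel (Sum.map id Sum.inl)) '' typeOf (L := L) (Sum.elim E b)
  let Γ2 : Set (L.Formula ((J × α) ⊕ (β ⊕ β'))) :=
    {χ | ∃ (σ : J) (m : ℕ) (t : Fin m → β ⊕ β') (φ : L.Formula (α ⊕ Fin m)),
      Divides (L := L) φ (Sum.elim b b' ∘ t) (range b) ∧
      χ = (φ.relabel (Sum.map (fun x => (σ, x)) t)).not}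
  have e1 : ∀ x : J × α → M, Sum.elim x (Sum.elim b b') ∘ Sum.map id Sum.inl = Sum.elim x b := by
    intro x
    ext (i | i) <;> rfl
  have e2 : ∀ (x : J × α → M) (σ : J) (m : ℕ) (t : Fin m → β ⊕ β'),
      Sum.elim x (Sum.elim b b') ∘ Sum.map (fun x => (σ, x)) t =
        Sum.elim (fun y => x (σ, y)) (Sum.elim b b' ∘ t) := by
    intro x σ m t
    ext (i | i) <;> rfl
  obtain ⟨E', hE'⟩ := sat_countable hM (Sum.elim b b') (Γ1 ∪ Γ2) (by
    intro Γ₀ hΓ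
    have h1 : ∀ χ : {χ // χ ∈ Γ₀ ∧ χ ∈ Γ1}, ∃ ψ ∈ typeOf (L := L) (Sum.elim E b),
      ψ.relabel (Sum.map id Sum.inl) = χ.1 := fun χ => χ.2.2
    choose ψ hψ1 hψ2 using h1
    have hf1 : Finite {χ // χ ∈ Γ₀ ∧ χ ∈ Γ1} :=
      Set.Finite.subset Γ₀.finite_toSet (fun χ (hχ : χ ∈ Γ₀ ∧ χ ∈ Γ1) => hχ.1)
    have hf2 : Finite {χ // χ ∈ Γ₀ ∧ χ ∈ Γ2} :=
      Set.Finite.subset Γ₀.finite_toSet (fun χ (hχ : χ ∈ Γ₀ ∧ χ ∈ Γ2) => hχ.1)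
    have h2 : ∀ χ : {χ // χ ∈ Γ₀ ∧ χ ∈ Γ2}, ∃ (σ : J) (m : ℕ) (t : Fin m → β ⊕ β')
      (φ : L.Formula (α ⊕ Fin m)),
      Divides (L := L) φ (Sum.elim b b' ∘ t) (range b) ∧
      χ.1 = (φ.relabel (Sum.map (fun x => (σ, x)) t)).not := fun χ => χ.2.2
    choose σ m t φ hφ1 hφ2 using h2
    obtain ⟨x, hx1, hx2⟩ := core T hst M hM b (Formula.iInf ψ) E
      (by rw [Formula.realize_iInf]; exact hψ1) (fun l y => (σ l, y)) m φ _ hφ1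
    rw [Formula.realize_iInf] at hx1
    refine ⟨x, fun χ hχ => ?_⟩
    rcases hΓ hχ with h | h
    · have h3 := hx1 ⟨χ, hχ, h⟩
      have h4 := hψ2 ⟨χ, hχ, h⟩
      rw [← e1 x, ← Formula.realize_relabel, h4] at h3
      exact h3
    · have h3 := hx2 ⟨χ, hχ, h⟩
      have h4 := hφ2 ⟨χ, hχ, h⟩
      simp only at h4
      rw [h4, Formula.realize_not, Formula.realize_relabel, e2]
      exact h3)
  refine ⟨E', ?_, ?_⟩
  · refine typeOf_eq_of_subset fun φ hφ => ?_
    have := hE' _ (Or.inl (mem_image_of_mem _ hφ))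
    rwa [Formula.realize_relabel, e1] at this
  · intro σ m c hc φ hφ hdiv
    have hc' : ∀ t, ∃ y : β ⊕ β', Sum.elim b b' y = c t := by
      intro t
      rcases hc t with ⟨y, hy⟩ | ⟨y, hy⟩
      · exact ⟨Sum.inr y, hy⟩
      · exact ⟨Sum.inl y, hy⟩
    choose t ht using hc'
    have hct : c = Sum.elim b b' ∘ t := funext fun i => (ht i).symm
    rw [hct] at hdiv hφ
    have := hE' _ (Or.inr ⟨σ, m, t, φ, hdiv, rfl⟩)
    rw [Formula.realize_not, Formula.realize_relabel, e2] at this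
    exact this hφ

end Core


theorem indisc_transfer {M N : Type*} [L.Structure M] [L.Structure N] {I γ : Type*}
    [LinearOrder I] (a : I → γ → N) (a' : I → γ → M)
    (h : typeOf (L := L) (fun p : I × γ => a p.1 p.2) = typeOf (fun p : I × γ => a' p.1 p.2))
    (ha : IsIndiscernible (L := L) a) : IsIndiscernible (L := L) a' := by
  intro n i j hi hj φ
  have h1 := typeOf_iff (typeOf_comp h (δ := Fin n × γ) (fun p => (i p.1, p.2))) φ
  have h2 := typeOf_iff (typeOf_comp h (δ := Fin n × γ) (fun p => (j p.1, p.2))) φ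
  exact h1.symm.trans ((ha n i j hi hj φ).trans h2)

/-- the sequence with first term `a0` and then the `c j` -/
def scons {X : Type*} (a0 : X) (c : ℕ → X) : ℕ → X
  | 0 => a0
  | j + 1 => c j

theorem witness {M : Type (max u v)} [L.Structure M] [Nonempty M] (hM : IsMonster (L := L) M)
    {α β : Type*} [Finite α] [Finite β] (b : β → M) (p q : Set (L.Formula (α ⊕ β)))
    (h : PfOver (L := L) b p q) (a0 : α → M) (h0 : typeOf (Sum.elim a0 b) = q) :
    ∃ c : ℕ → α → M, IsIndiscernible (L := L) (scons a0 c) ∧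
      ∀ j, typeOf (Sum.elim (c j) b) = p := by
  obtain ⟨a, ha1, ha2, ha3⟩ := h
  obtain ⟨d, hd⟩ := extend_countable hM (Sum.elim (a 0) b) (Sum.elim a0 b) (ha3.trans h0.symm)
    (fun p : ℕ × α => a (p.1 + 1) p.2)
  refine ⟨fun j x => d (j, x), ?_, fun j => ?_⟩
  · refine indisc_transfer a _ ?_ ha1
    have := typeOf_comp hd (δ := ℕ × α) (fun p => match p with
      | (0, x) => Sum.inl (Sum.inl x)
      | (j + 1, x) => Sum.inr (j, x))
    convert this using 2
    · ext ⟨i, x⟩; cases i <;> rfl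
    · ext ⟨i, x⟩; cases i <;> rfl
  · rw [← ha2 (j + 1) (Nat.succ_pos j)]
    have := typeOf_comp hd (δ := α ⊕ β)
      (Sum.elim (fun x => Sum.inr (j, x)) (fun y => Sum.inl (Sum.inr y)))
    symm
    convert this using 2
    · ext (x | x) <;> rfl
    · ext (x | x) <;> rfl

/-- the tree -/
theorem exists_tree {M : Type (max u v)} [L.Structure M] [Nonempty M] (hM : IsMonster (L := L) M)
    {α β : Type*} [Finite α] [Finite β] (b : β → M) (P : ℕ → Set (L.Formula (α ⊕ β)))
    (h0 : ∃ a : α → M, typeOf (Sum.elim a b) = P 0)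
    (hP : ∀ k, PfOver (L := L) b (P (k + 1)) (P k)) :
    ∃ e : List ℕ → α → M, (∀ σ, typeOf (Sum.elim (e σ) b) = P σ.length) ∧
      ∀ σ, IsIndiscernible (L := L) (scons (e σ) (fun j => e (j :: σ))) := by
  have hw : ∀ k (a : α → M), typeOf (Sum.elim a b) = P k → ∃ c : ℕ → α → M,
      IsIndiscernible (L := L) (scons a c) ∧ ∀ j, typeOf (Sum.elim (c j) b) = P (k + 1) :=
    fun k a ha => witness hM b _ _ (hP k) a ha
  choose! W hW1 hW2 using hw
  obtain ⟨a0, ha0⟩ := h0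
  let e : List ℕ → α → M := fun σ =>
    List.rec a0 (fun j τ a => W τ.length a j) σ
  have he : ∀ σ, typeOf (Sum.elim (e σ) b) = P σ.length := by
    intro σ
    induction σ with
    | nil => exact ha0
    | cons j τ ih => exact hW2 _ _ ih j
  exact ⟨e, he, fun σ => hW1 _ _ (he σ)⟩

/-- the tree, independent from `b'` -/
theorem exists_tree_indep (T : L.Theory) (hst : IsStable T)
    (M : Theory.ModelType.{u, v, max u v} T) (hM : IsMonster (L := L) M)
    {α β β' : Type (max u v)} [Finite α] [Finite β] [Finite β']
    (b : β → M) (b' : β' → M) (P : ℕ → Set (L.Formula (α ⊕ β)))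
    (h0 : ∃ a : α → M, typeOf (Sum.elim a b) = P 0)
    (hP : ∀ k, PfOver (L := L) b (P (k + 1)) (P k)) :
    ∃ e : List ℕ → α → M, (∀ σ, typeOf (Sum.elim (e σ) b) = P σ.length) ∧
      (∀ σ, IsIndiscernible (L := L) (scons (e σ) (fun j => e (j :: σ)))) ∧
      ∀ σ, IndepOver (L := L) (e σ) (range b') (range b) := by
  obtain ⟨e, he1, he2⟩ := exists_tree hM b P h0 hP
  obtain ⟨E, hE1, hE2⟩ := exists_indep T hst M hM b b' (fun p : List ℕ × α => e p.1 p.2)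
  refine ⟨fun σ x => E (σ, x), fun σ => ?_, fun σ => ?_, hE2⟩
  · rw [← he1 σ]
    have := typeOf_comp hE1 (δ := α ⊕ β) (Sum.elim (fun x => Sum.inl (σ, x)) Sum.inr)
    symm
    convert this using 2
    · ext (x | x) <;> rfl
    · ext (x | x) <;> rfl
  · refine indisc_transfer _ _ ?_ (he2 σ)
    have := typeOf_comp hE1 (δ := ℕ × α) (fun p => match p with
      | (0, x) => Sum.inl (σ, x)
      | (j + 1, x) => Sum.inl (j :: σ, x))
    convert this using 2
    · ext ⟨i, x⟩; cases i <;> rfl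
    · ext ⟨i, x⟩; cases i <;> rfl

/-- `q` is a type over `c` in the closure of level `k` of the tree -/
def InQ {M : Type*} [L.Structure M] {α δ : Type*} (e : List ℕ → α → M) (c : δ → M) (k : ℕ)
    (q : Set (L.Formula (α ⊕ δ))) : Prop :=
  (∃ a : α → M, typeOf (Sum.elim a c) = q) ∧
    ∀ χ ∈ q, ∃ σ : List ℕ, σ.length = k ∧ χ.Realize (Sum.elim (e σ) c)

theorem scons_strictMono (f : ℕ → ℕ) (hf : StrictMono f) :
    StrictMono (scons 0 (fun i => f i + 1)) := by
  refine strictMono_nat_of_lt_succ fun n => ?_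
  cases n with
  | zero => simp [scons]
  | succ n => simpa [scons] using hf (Nat.lt_succ_self n)

theorem step_back {M : Type (max u v)} [L.Structure M] [Nonempty M] (hM : IsMonster (L := L) M)
    {α δ : Type*} [Finite α] [Finite δ] (e : List ℕ → α → M) (c : δ → M)
    (he : ∀ σ, IsIndiscernible (L := L) (scons (e σ) (fun j => e (j :: σ))))
    (k : ℕ) (q : Set (L.Formula (α ⊕ δ))) (hq : InQ e c k q) :
    ∃ q', InQ e c (k + 1) q' ∧ PfOver (L := L) c q' q := by
  classical
  obtain ⟨⟨a0, ha0⟩, hq2⟩ := hq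
  have hmem : ∀ χ, χ ∈ q ↔ χ.Realize (Sum.elim a0 c) := by
    intro χ; rw [← ha0, mem_typeOf]
  let sq : List ℕ → (ℕ → ℕ) → ℕ × α → M :=
    fun σ f p => scons (e σ) (fun i => e (f i :: σ)) p.1 p.2
  let Good : Set (L.Formula ((ℕ × α) ⊕ δ)) := {ψ | ∃ χ ∈ q, ∀ σ : List ℕ, σ.length = k →
    χ.Realize (Sum.elim (e σ) c) → ∃ S ∈ Filter.hyperfilter ℕ, ∀ f : ℕ → ℕ, StrictMono f →
      (∀ i, f i ∈ S) → ψ.Realize (Sum.elim (sq σ f) c)}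
  have htop : (⊤ : L.Formula (α ⊕ δ)) ∈ q := by rw [hmem]; exact Formula.realize_top.2 trivial
  have hsat := sat_countable hM c Good (by
    intro Γ₀ hΓ
    have h1 : ∀ ψ : Γ₀, ∃ χ ∈ q, ∀ σ : List ℕ, σ.length = k →
      χ.Realize (Sum.elim (e σ) c) → ∃ S ∈ Filter.hyperfilter ℕ, ∀ f : ℕ → ℕ, StrictMono f →
      (∀ i, f i ∈ S) → ψ.1.Realize (Sum.elim (sq σ f) c) := fun ψ => hΓ ψ.2
    choose χ hχ1 hχ2 using h1
    obtain ⟨σ, hσ1, hσ2⟩ := hq2 (Formula.iInf χ) (by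
      rw [hmem, Formula.realize_iInf]
      exact fun ψ => (hmem _).1 (hχ1 ψ))
    rw [Formula.realize_iInf] at hσ2
    choose S hS1 hS2 using fun ψ => hχ2 ψ σ hσ1 (hσ2 ψ)
    have hS3 : (⋂ ψ, S ψ) ∈ Filter.hyperfilter ℕ := Filter.iInter_mem.2 hS1
    have hinf : (setOf fun x => x ∈ ⋂ ψ, S ψ).Infinite := by
      intro hfin
      exact Filter.notMem_hyperfilter_of_finite hfin hS3
    refine ⟨sq σ (Nat.nth (fun x => x ∈ ⋂ ψ, S ψ)), fun ψ hψ => ?_⟩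
    refine hS2 ⟨ψ, hψ⟩ _ (Nat.nth_strictMono hinf) fun i => ?_
    exact mem_iInter.1 (Nat.nth_mem_of_infinite hinf i) _)
  obtain ⟨a, ha⟩ := hsat
  let A : ℕ → α → M := fun i x => a (i, x)
  have hA : ∀ i (χ : L.Formula (α ⊕ δ)) (a : ℕ × α → M),
      (χ.relabel (Sum.map (fun x => (i, x)) id)).Realize (Sum.elim a c) ↔
      χ.Realize (Sum.elim (fun x => a (i, x)) c) := by
    intro i χ a
    rw [Formula.realize_relabel]
    have : Sum.elim a c ∘ Sum.map (fun x => (i, x)) id = Sum.elim (fun x => a (i, x)) c := by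
      ext (x | x) <;> rfl
    rw [this]
  refine ⟨typeOf (Sum.elim (A 1) c), ⟨⟨A 1, rfl⟩, ?_⟩, A, ?_, ?_, ?_⟩
  · intro χ hχ
    by_contra hcon
    push Not at hcon
    have := ha (χ.not.relabel (Sum.map (fun x => (1, x)) id)) ⟨⊤, htop, fun σ hσ _ =>
      ⟨univ, Filter.univ_mem, fun f hf _ => by
        rw [hA, Formula.realize_not]
        exact hcon (f 0 :: σ) (by simp [hσ])⟩⟩
    rw [hA, Formula.realize_not] at this
    exact this hχ
  · intro m i j hi hj φ
    have hB : ∀ (i : Fin m → ℕ) (a : ℕ × α → M),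
      (φ.relabel (fun p : Fin m × α => (Sum.inl (i p.1, p.2) : (ℕ × α) ⊕ δ))).Realize
        (Sum.elim a c) ↔ φ.Realize (fun p => a (i p.1, p.2)) := by
      intro i a
      rw [Formula.realize_relabel]
      rfl
    have := ha ((φ.relabel (fun p : Fin m × α => (Sum.inl (i p.1, p.2) : (ℕ × α) ⊕ δ))).iff
      (φ.relabel (fun p : Fin m × α => (Sum.inl (j p.1, p.2) : (ℕ × α) ⊕ δ))))
      ⟨⊤, htop, fun σ hσ _ => ⟨univ, Filter.univ_mem, fun f hf _ => by
        rw [Formula.realize_iff, hB, hB]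
        have h1 := he σ m (fun t => scons 0 (fun i => f i + 1) (i t))
          (fun t => scons 0 (fun i => f i + 1) (j t))
          ((scons_strictMono f hf).comp hi) ((scons_strictMono f hf).comp hj) φ
        have h2 : ∀ t, scons (e σ) (fun j => e (j :: σ)) (scons 0 (fun i => f i + 1) t) =
            scons (e σ) (fun i => e (f i :: σ)) t := by
          intro t; cases t <;> rfl
        simp only [h2] at h1
        exact h1⟩⟩
    rw [Formula.realize_iff, hB, hB] at this
    exact this
  · intro i hi
    obtain ⟨i, rfl⟩ := Nat.exists_eq_succ_of_ne_zero hi.ne'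
    ext χ
    have := ha ((χ.relabel (Sum.map (fun x => (i + 1, x)) id)).iff
      (χ.relabel (Sum.map (fun x => (1, x)) id))) ⟨⊤, htop, fun σ hσ _ => by
        by_cases h : {j | χ.Realize (Sum.elim (e (j :: σ)) c)} ∈ Filter.hyperfilter ℕ
        · refine ⟨_, h, fun f hf hS => ?_⟩
          rw [Formula.realize_iff, hA, hA]
          exact iff_of_true (hS i) (hS 0)
        · rw [← Ultrafilter.compl_mem_iff_notMem] at h
          refine ⟨_, h, fun f hf hS => ?_⟩
          rw [Formula.realize_iff, hA, hA]
          exact iff_of_false (hS i) (hS 0)⟩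
    rw [Formula.realize_iff, hA, hA] at this
    exact this
  · rw [← ha0]
    refine (typeOf_eq_of_subset fun χ hχ => ?_).symm
    have hχq : χ ∈ q := ha0 ▸ hχ
    have := ha (χ.relabel (Sum.map (fun x => (0, x)) id)) ⟨χ, hχq, fun σ hσ h =>
      ⟨univ, Filter.univ_mem, fun f hf _ => by rw [hA]; exact h⟩⟩
    rw [hA] at this
    exact this

theorem InQ.nf {M : Type*} [L.Structure M] {α β β' : Type*} {e : List ℕ → α → M} {b : β → M}
    {b' : β' → M} {k : ℕ} {q : Set (L.Formula (α ⊕ (β ⊕ β')))}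
    (hq : InQ e (Sum.elim b b') k q) (P : Set (L.Formula (α ⊕ β)))
    (h1 : ∀ σ, σ.length = k → typeOf (Sum.elim (e σ) b) = P)
    (h2 : ∀ σ, IndepOver (L := L) (e σ) (range b') (range b)) : IsNFExt (L := L) b b' P q := by
  obtain ⟨⟨a, rfl⟩, hq2⟩ := hq
  refine ⟨a, ?_, rfl, ?_⟩
  · obtain ⟨σ0, hσ0, -⟩ := hq2 ⊤ (Formula.realize_top.2 trivial)
    rw [← h1 σ0 hσ0]
    refine typeOf_eq_of_subset fun φ hφ => ?_
    have e1 : ∀ a : α → M, Sum.elim a (Sum.elim b b') ∘ Sum.map id Sum.inl = Sum.elim a b := by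
      intro a; ext (x | x) <;> rfl
    obtain ⟨σ, hσ, h3⟩ := hq2 (φ.relabel (Sum.map id Sum.inl)) (by
      rw [mem_typeOf, Formula.realize_relabel, e1]; exact hφ)
    rw [Formula.realize_relabel, e1, ← mem_typeOf, h1 σ hσ, ← h1 σ0 hσ0] at h3
    exact h3
  · intro m c hc φ hφ hdiv
    have hc' : ∀ t, ∃ y : β ⊕ β', Sum.elim b b' y = c t := by
      intro t
      rcases hc t with ⟨y, hy⟩ | ⟨y, hy⟩
      · exact ⟨Sum.inr y, hy⟩
      · exact ⟨Sum.inl y, hy⟩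
    choose t ht using hc'
    have e1 : ∀ a : α → M, Sum.elim a (Sum.elim b b') ∘ Sum.map id t = Sum.elim a c := by
      intro a; ext (x | x)
      · rfl
      · exact ht x
    obtain ⟨σ, hσ, h3⟩ := hq2 (φ.relabel (Sum.map id t)) (by
      rw [mem_typeOf, Formula.realize_relabel, e1]; exact hφ)
    rw [Formula.realize_relabel, e1] at h3
    exact h2 σ m c hc φ h3 hdiv

theorem combi {X Y : Type*} (R : X → X → Prop) (N : Y → X → Prop)
    (hN : ∀ y y' x, N y x → N y' x → y = y') (n : ℕ) (hn : 0 < n) (p : ℕ → Y)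
    (hper : ∀ i, p (i + n) = p i) (hproper : ∀ i j, i < n → j < n → i ≠ j → p i ≠ p j)
    (hfin : {x | N (p 0) x}.Finite) (q : ℕ → X) (hq : ∀ k, N (p (k * (n - 1))) (q k))
    (hR : ∀ k, R (q (k + 1)) (q k)) :
    ∃ (m : ℕ), 0 < m ∧ ∃ r : ℕ → X, N (p 0) (r 0) ∧ (∀ i, r (i + m * n) = r i) ∧
      (∀ i, R (r i) (r (i + 1))) ∧ ∀ i j, i < m * n → j < m * n → i ≠ j → r i ≠ r j := by
  classical
  have hmod : ∀ i, p (i % n) = p i := fun i => Function.Periodic.map_mod_nat hper i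
  have hdvd : ∀ i, n ∣ i → p i = p 0 := by
    intro i hi
    rw [← hmod i, Nat.mod_eq_zero_of_dvd hi]
  have hinj : ∀ i j, p i = p j → i ≡ j [MOD n] := by
    intro i j hij
    rw [← hmod i, ← hmod j] at hij
    by_contra h
    exact hproper _ _ (Nat.mod_lt _ hn) (Nat.mod_lt _ hn) h hij
  have hex : ∃ d, 0 < d ∧ ∃ i, q i = q (i + d) := by
    obtain ⟨k, l, hkl, h⟩ := hfin.exists_lt_map_eq_of_forall_mem (f := fun k : ℕ => q (k * n))
      (fun k => by
        have := hq (k * n)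
        rw [hdvd _ ((Dvd.intro_left k rfl).mul_right _)] at this
        exact this)
    have h1 : k * n < l * n := Nat.mul_lt_mul_of_pos_right hkl hn
    exact ⟨l * n - k * n, by omega, k * n, by rw [Nat.add_sub_cancel' h1.le]; exact h⟩
  have hmin := fun d' (h : d' < Nat.find hex) => Nat.find_min hex h
  obtain ⟨hd, i, hi⟩ := Nat.find_spec hex
  set d := Nat.find hex with hd_def
  have hnd : n ∣ d := by
    have h1 : p (i * (n - 1)) = p ((i + d) * (n - 1)) := hN _ _ _ (hq i) (hi ▸ hq (i + d))
    have h2 := hinj _ _ h1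
    rw [add_mul] at h2
    have h3 : n ∣ d * (n - 1) := by
      have h4 : i * (n - 1) + 0 ≡ i * (n - 1) + d * (n - 1) [MOD n] := by simpa using h2
      exact (Nat.modEq_zero_iff_dvd).1 (Nat.ModEq.add_left_cancel' _ h4).symm
    have hcop : Nat.Coprime n (n - 1) := by
      have := Nat.coprime_self_add_left (m := 1) (n := n - 1)
      have h5 : n = n - 1 + 1 := by omega
      rw [h5]; simp
    exact hcop.dvd_of_dvd_mul_right h3
  obtain ⟨m, hm⟩ := hnd
  have hmd : m * n = d := by rw [hm, mul_comm]
  have hm0 : 0 < m := by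
    rcases Nat.eq_zero_or_pos m with h | h
    · subst h; omega
    · exact h
  let c : ℕ → X := fun t => q (i + t % d)
  have hcinj : ∀ t t', c t = c t' → t ≡ t' [MOD d] := by
    intro t t' h
    have h1 : t % d < d := Nat.mod_lt _ hd
    have h2 : t' % d < d := Nat.mod_lt _ hd
    rcases lt_trichotomy (t % d) (t' % d) with h3 | h3 | h3
    · refine absurd ⟨?_, i + t % d, ?_⟩ (hmin (t' % d - t % d) (by omega))
      · omega
      · rw [show i + t % d + (t' % d - t % d) = i + t' % d by omega]; exact h
    · exact h3
    · refine absurd ⟨?_, i + t' % d, ?_⟩ (hmin (t % d - t' % d) (by omega))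
      · omega
      · rw [show i + t' % d + (t % d - t' % d) = i + t % d by omega]; exact h.symm
  have hcR : ∀ t, R (c (t + 1)) (c t) := by
    intro t
    have h1 : t % d < d := Nat.mod_lt _ hd
    by_cases h : t % d + 1 < d
    · have h2 : (t + 1) % d = t % d + 1 := by
        rw [Nat.add_mod, Nat.mod_eq_of_lt (show 1 < d by omega), Nat.mod_eq_of_lt h]
      change R (q (i + (t + 1) % d)) (q (i + t % d))
      rw [h2]
      exact hR _
    · have h2 : t % d + 1 = d := by omega
      have h3 : (t + 1) % d = 0 := by
        rw [← Nat.mod_add_mod, h2, Nat.mod_self]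
      change R (q (i + (t + 1) % d)) (q (i + t % d))
      rw [h3, add_zero, hi, show i + d = i + t % d + 1 by omega]
      exact hR _
  have hccong : ∀ t t', t ≡ t' [MOD d] → c t = c t' := by
    intro t t' h
    change q (i + t % d) = q (i + t' % d)
    rw [h]
  refine ⟨m, hm0, fun t => c (i * (n - 1) + t * (d - 1)), ?_, ?_, ?_, ?_⟩
  · have h1 := hq (i + (i * (n - 1) + 0 * (d - 1)) % d)
    rw [hdvd] at h1
    · exact h1
    · refine Dvd.dvd.mul_right ?_ _
      rw [zero_mul, add_zero]
      have h2 : i + i * (n - 1) = i * n := by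
        obtain ⟨n', rfl⟩ := Nat.exists_eq_succ_of_ne_zero hn.ne'
        simp only [Nat.succ_sub_one, Nat.succ_eq_add_one]; ring
      have h3 : i + i * (n - 1) % d ≡ i + i * (n - 1) [MOD n] := by
        refine Nat.ModEq.add_left _ ?_
        exact Nat.ModEq.of_dvd ⟨m, hm⟩ (Nat.mod_modEq _ _)
      rw [h2] at h3
      exact (Nat.modEq_zero_iff_dvd).1 (h3.trans ((Nat.modEq_zero_iff_dvd).2 (Dvd.intro_left _ rfl)))
  · intro t
    refine hccong _ _ ?_
    rw [hmd, add_mul, ← add_assoc]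
    simp [Nat.ModEq]
  · intro t
    have := hcR (i * (n - 1) + (t + 1) * (d - 1))
    rwa [hccong (i * (n - 1) + (t + 1) * (d - 1) + 1) (i * (n - 1) + t * (d - 1)) ?_] at this
    have h2 : i * (n - 1) + (t + 1) * (d - 1) + 1 = i * (n - 1) + t * (d - 1) + d := by
      rw [add_mul]; omega
    rw [h2]
    simp [Nat.ModEq]
  · intro t t' ht ht' hne heq
    rw [hmd] at ht ht'
    have h1 := Nat.ModEq.add_left_cancel' _ (hcinj _ _ heq)
    have hcop : Nat.gcd d (d - 1) = 1 := by
      have h5 : d = d - 1 + 1 := by omega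
      rw [h5]; simp
    have h2 := Nat.ModEq.cancel_right_of_coprime hcop h1
    exact hne (Nat.ModEq.eq_of_lt_of_lt h2 ht ht')

end Helpers

/-- In a stable theory, if `p₀(x,b) ⟶ … ⟶ p_{n-1}(x,b) ⟶ p₀(x,b)` is a proper
cycle of types over `b` (encoded as an `n`-periodic sequence) and `b'` is a tuple such that
`p₀(x,b)` has only finitely many distinct nonforking extensions to `b, b'`, then there is a
proper cycle of types, starting with some nonforking extension `p₀'(x; b, b')` of `p₀(x,b)`,
whose length is a (positive) multiple of `n`. -/
theorem cycle_nonforking_extension (hT : T.IsComplete) (hst : IsStable T)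
    (M : Theory.ModelType.{u, v, max u v} T) (hM : IsMonster (L := L) M)
    {α β β' : Type (max u v)} [Finite α] [Finite β] [Finite β']
    (b : β → M) (b' : β' → M) (n : ℕ) (hn : 0 < n)
    (p : ℕ → Set (L.Formula (α ⊕ β)))
    (hreal : ∀ i, ∃ a : α → M, typeOf (Sum.elim a b) = p i)
    (hper : ∀ i, p (i + n) = p i)
    (hcyc : ∀ i, PfOver (L := L) b (p i) (p (i + 1)))
    (hproper : ∀ i j, i < n → j < n → i ≠ j → p i ≠ p j)
    (hfin : {q : Set (L.Formula (α ⊕ (β ⊕ β'))) | IsNFExt (L := L) b b' (p 0) q}.Finite) :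
    ∃ (m : ℕ), 0 < m ∧ ∃ r : ℕ → Set (L.Formula (α ⊕ (β ⊕ β'))),
      IsNFExt (L := L) b b' (p 0) (r 0) ∧
      (∀ i, r (i + m * n) = r i) ∧
      (∀ i, PfOver (L := L) (Sum.elim b b') (r i) (r (i + 1))) ∧
      ∀ i j, i < m * n → j < m * n → i ≠ j → r i ≠ r j := by
  have hP : ∀ k, PfOver (L := L) b (p ((k + 1) * (n - 1))) (p (k * (n - 1))) := by
    intro k
    have h := hcyc ((k + 1) * (n - 1))
    have e1 : (k + 1) * (n - 1) + 1 = k * (n - 1) + n := by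
      rw [add_mul]; omega
    rw [e1, hper] at h
    exact h
  obtain ⟨e, he1, he2, he3⟩ := exists_tree_indep T hst M hM b b' (fun k => p (k * (n - 1)))
    (by simpa using hreal 0) hP
  have hstep : ∀ k q, InQ e (Sum.elim b b') k q → ∃ q', InQ e (Sum.elim b b') (k + 1) q' ∧
      PfOver (L := L) (Sum.elim b b') q' q :=
    fun k q hq => step_back hM e (Sum.elim b b') he2 k q hq
  choose! F hF1 hF2 using hstep
  let q : ℕ → Set (L.Formula (α ⊕ (β ⊕ β'))) := fun k =>
    Nat.rec (typeOf (Sum.elim (e []) (Sum.elim b b'))) (fun k x => F k x) k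
  have hq : ∀ k, InQ e (Sum.elim b b') k (q k) := by
    intro k
    induction k with
    | zero => exact ⟨⟨e [], rfl⟩, fun χ hχ => ⟨[], rfl, hχ⟩⟩
    | succ k ih => exact hF1 k _ ih
  refine combi (PfOver (L := L) (Sum.elim b b')) (IsNFExt (L := L) b b') ?_ n hn p hper hproper
    hfin q (fun k => (hq k).nf _ (fun σ hσ => by rw [he1, hσ]) he3) (fun k => hF2 k _ (hq k))
  rintro y y' x ⟨a, rfl, h1, -⟩ ⟨a', rfl, h2, -⟩
  have h3 := typeOf_comp (h1.trans h2.symm) (δ := α ⊕ β) (Sum.map id Sum.inl)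
  convert h3 using 2
  · ext (x | x) <;> rfl
  · ext (x | x) <;> rfl

end Equationality
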